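/- arXiv:2202.06364 — 2 statements merged into one kernel-verified Lean document; each statement's English description precedes it below -/
import Mathlib

section
/- Let N be a positive integer, let A be an N×N integer matrix with (A − I)^m = 0 for some positive integer m, let c ∈ (ℂˣ)^N, and define φ : (ℂˣ)^N → (ℂˣ)^N by letting the i-th coordinate of φ(x) be c_i · ∏_j x_j^{A_{ij}} (integer exponents). Assume that for every nonzero vector v ∈ ℤ^N with Aᵀv = v, the number ∏_i c_i^{v_i} is not a root of unity. Then φ is wild: for every x ∈ (ℂˣ)^N, the forward orbit {φ^k(x) : k ∈ ℕ} is Zariski dense, i.e., the only polynomial in N variables over ℂ vanishing at every point of the forward orbit is the zero polynomial. -/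
section Aux

variable {M : Type*} [AddCommGroup M]

/-- A periodic point of a unipotent map is fixed. -/
theorem aux_periodic (htf : ∀ (k : ℕ) (u : M), 0 < k → k • u = 0 → u = 0)
    (P : Module.End ℤ M) (k : ℕ) (hk : 0 < k) (n : ℕ) :
    ∀ v : M, (P ^ n) v = 0 → ((1 + P) ^ k) v = v → P v = 0 := by
  induction n with
  | zero => intro v hv _; simp at hv; simp [hv]
  | succ n ih =>
    intro v hv hkv
    have hPP : P (P v) = 0 := by
      apply ih
      · rw [pow_succ] at hv; exact hv
      · have hcomm : Commute ((1 + P) ^ k) P :=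
          ((Commute.one_left P).add_left (Commute.refl P)).pow_left k
        have := congrArg (fun T : Module.End ℤ M => T v) hcomm.eq
        simp only [Module.End.mul_apply] at this
        rw [this, hkv]
    have hform : ∀ j : ℕ, ((1 + P) ^ j) v = v + j • P v := by
      intro j
      induction j with
      | zero => simp
      | succ j ihj =>
        rw [pow_succ', Module.End.mul_apply, ihj]
        simp [hPP, add_smul]
        abel
    rw [hform] at hkv
    exact htf k _ hk (by simpa using hkv)

theorem aux_invariant (htf : ∀ (k : ℕ) (u : M), 0 < k → k • u = 0 → u = 0)
    (P : Module.End ℤ M) (m : ℕ) (hP : P ^ m = 0)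
    (γ : M → ℂ) (hγ0 : ∀ v, γ v ≠ 0) (hγ : ∀ v, P v = 0 → γ v = 1 → v = 0)
    (h : M →₀ ℂ) (hinv : ∀ v, h (v + P v) = γ v * h v) (v : M) (hv : h v ≠ 0) : v = 0 := by
  have horb : ∀ j : ℕ, h (((1 + P) ^ j) v) ≠ 0 := by
    intro j
    induction j with
    | zero => simpa using hv
    | succ j ih =>
      have : ((1 + P) ^ (j + 1)) v = ((1 + P) ^ j) v + P (((1 + P) ^ j) v) := by
        rw [pow_succ', Module.End.mul_apply]; simp
      rw [this, hinv]
      exact mul_ne_zero (hγ0 _) ih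
  have hU : IsUnit (1 + P) := IsNilpotent.isUnit_one_add ⟨m, hP⟩
  have hPv : P v = 0 := by
    have hninj : ¬ Function.Injective
        (fun j : ℕ => (⟨((1 + P) ^ j) v, by simpa using horb j⟩ : h.support)) :=
      not_injective_infinite_finite _
    rw [Function.Injective] at hninj
    push Not at hninj
    obtain ⟨i, j, hij, hne⟩ := hninj
    have hij' : ((1 + P) ^ i) v = ((1 + P) ^ j) v := by simpa using hij
    have key : ∀ i j : ℕ, i < j → ((1 + P) ^ i) v = ((1 + P) ^ j) v → P v = 0 := by
      intro i j hlt he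
      obtain ⟨k, rfl⟩ := Nat.exists_eq_add_of_lt hlt
      have hinj := ((Module.End.isUnit_iff _).1 (hU.pow i)).1
      have : ((1 + P) ^ (k + 1)) v = v := by
        apply hinj
        rw [← Module.End.mul_apply, ← pow_add, he, add_assoc]
      exact aux_periodic htf P (k + 1) (Nat.succ_pos k) m v (by simp [hP]) this
    rcases lt_or_gt_of_ne hne with hlt | hlt
    · exact key i j hlt hij'
    · exact key j i hlt hij'.symm
  have := hinv v
  rw [hPv, add_zero] at this
  apply hγ v hPv
  have h2 : (γ v - 1) * h v = 0 := by linear_combination -this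
  rcases mul_eq_zero.1 h2 with h3 | h3
  · exact sub_eq_zero.1 h3
  · exact absurd h3 hv

theorem aux_main (htf : ∀ (k : ℕ) (u : M), 0 < k → k • u = 0 → u = 0)
    (P : Module.End ℤ M) (m : ℕ) (hP : P ^ m = 0)
    (γ : M → ℂ) (hγ1 : γ 0 = 1)
    (hγ0 : ∀ v, γ v ≠ 0) (hγ : ∀ v, P v = 0 → γ v = 1 → v = 0)
    (σ : (M →₀ ℂ) → (M →₀ ℂ)) (hσ : ∀ h v, σ h (v + P v) = γ v * h v) (d : ℕ) :
    ∀ J : Submodule ℂ (M →₀ ℂ),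
      (∀ f ∈ J, ∀ v, f v ≠ 0 → (P ^ d) v = 0) →
      (∀ f ∈ J, ∀ u, (P ^ d) u = 0 → Finsupp.equivMapDomain (Equiv.addLeft u) f ∈ J) →
      (∀ f ∈ J, σ f ∈ J) → (∃ f ∈ J, f ≠ 0) → Finsupp.single 0 1 ∈ J := by
  classical
  have hU : IsUnit (1 + P) := IsNilpotent.isUnit_one_add ⟨m, hP⟩
  have hsurj : ∀ w : M, ∃ v, w = v + P v := by
    intro w
    obtain ⟨v, hv⟩ := ((Module.End.isUnit_iff _).1 hU).2 w
    exact ⟨v, by simpa using hv.symm⟩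
  induction d with
  | zero =>
    rintro J hsupp - - ⟨f, hfJ, hf⟩
    have h1 : f = Finsupp.single 0 (f 0) := by
      ext v
      by_cases hv : v = 0
      · simp [hv]
      · rw [Finsupp.single_eq_of_ne hv]
        by_contra h
        exact hv (by simpa using hsupp f hfJ v h)
    have h0 : f 0 ≠ 0 := by
      intro h; rw [h] at h1; simp at h1; exact hf h1
    have := J.smul_mem (f 0)⁻¹ hfJ
    rw [h1] at this
    simpa [h0] using this
  | succ d ih =>
    rintro J hsupp hmul hstab hne
    set T := P ^ d with hT
    have hTB : ∀ v, (P ^ (d + 1)) v = 0 → T (v + P v) = T v := by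
      intro v hv
      rw [pow_succ, Module.End.mul_apply] at hv
      rw [map_add, hT, hv, add_zero]
    let cos : (M →₀ ℂ) → Finset M := fun f => f.support.image T
    have hcos : ∀ (f : M →₀ ℂ) (S : Finset M),
        cos f ⊆ S ↔ ∀ v, f v ≠ 0 → T v ∈ S := by
      intro f S
      simp [cos, Finset.image_subset_iff]
    -- a nonzero element with the fewest cosets
    have hex : ∃ n, ∃ f ∈ J, f ≠ 0 ∧ (cos f).card = n := by
      obtain ⟨f, hfJ, hf⟩ := hne
      exact ⟨_, f, hfJ, hf, rfl⟩
    obtain ⟨f₀, hf₀J, hf₀, hcard₀⟩ := Nat.find_spec hex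
    have hmin : ∀ f ∈ J, f ≠ 0 → Nat.find hex ≤ (cos f).card := fun f hfJ hf =>
      Nat.find_min' hex ⟨f, hfJ, hf, rfl⟩
    obtain ⟨v₀, hv₀⟩ : ∃ v, f₀ v ≠ 0 := by
      by_contra hcon
      push Not at hcon
      exact hf₀ (Finsupp.ext hcon)
    -- translate
    set f := Finsupp.equivMapDomain (Equiv.addLeft (-v₀)) f₀ with hfdef
    have hfv : ∀ v, f v = f₀ (v₀ + v) := by
      intro v; simp [hfdef]
    have hfJ : f ∈ J := hmul f₀ hf₀J _ (by rw [map_neg, hsupp f₀ hf₀J v₀ hv₀, neg_zero])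
    have hf00 : f 0 ≠ 0 := by rw [hfv]; simpa using hv₀
    set S := cos f with hS
    have hScard : S.card ≤ Nat.find hex := by
      rw [← hcard₀]
      have : S ⊆ (cos f₀).image (fun y => y - T v₀) := by
        rw [hS, hcos]
        intro v hv
        rw [hfv] at hv
        refine Finset.mem_image.2 ⟨T (v₀ + v), ?_, by simp⟩
        exact Finset.mem_image_of_mem _ (by simpa using hv)
      exact (Finset.card_le_card this).trans Finset.card_image_le
    have h0S : (0 : M) ∈ S := by
      have := ((hcos f S).1 (le_refl _)) 0 hf00
      simpa using this
    -- the ideal of zero components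
    let J₁ : Submodule ℂ (M →₀ ℂ) := J ⊓ Finsupp.supported ℂ ℂ {v | T v ∈ S}
    have hJ₁ : ∀ g, g ∈ J₁ ↔ g ∈ J ∧ ∀ v, g v ≠ 0 → T v ∈ S := by
      intro g
      simp only [J₁, Submodule.mem_inf, Finsupp.mem_supported, Set.subset_def]
      simp
    let J' : Submodule ℂ (M →₀ ℂ) := J₁.map
      ({ toFun := Finsupp.filter (fun v => T v = 0)
         map_add' := fun _ _ => Finsupp.filter_add
         map_smul' := fun _ _ => Finsupp.filter_smul } : (M →₀ ℂ) →ₗ[ℂ] (M →₀ ℂ))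
    have hJ' : ∀ g, g ∈ J' ↔ ∃ h ∈ J₁, Finsupp.filter (fun v => T v = 0) h = g := by
      intro g
      exact Iff.rfl
    have hσS : ∀ h ∈ J₁, σ h ∈ J₁ := by
      intro h hh
      rw [hJ₁] at hh ⊢
      refine ⟨hstab h hh.1, fun w hw => ?_⟩
      obtain ⟨v, rfl⟩ := hsurj w
      rw [hσ] at hw
      have hv := right_ne_zero_of_mul hw
      rw [hTB v (hsupp h hh.1 v hv)]
      exact hh.2 v hv
    have h1 : Finsupp.single 0 1 ∈ J' := by
      apply ih
      · intro g hg v hv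
        obtain ⟨h, hh, rfl⟩ := (hJ' g).1 hg
        by_contra hcon
        exact hv (Finsupp.filter_apply_neg _ _ hcon)
      · intro g hg u hu
        obtain ⟨h, hh, rfl⟩ := (hJ' g).1 hg
        refine (hJ' _).2 ⟨Finsupp.equivMapDomain (Equiv.addLeft u) h, ?_, ?_⟩
        · rw [hJ₁] at hh ⊢
          refine ⟨hmul h hh.1 u ?_, ?_⟩
          · rw [pow_succ', Module.End.mul_apply, hu, map_zero]
          · intro v hv
            have := hh.2 _ (by simpa using hv)
            simpa [hu] using this
        · ext v
          simp [Finsupp.filter_apply, hu]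
      · intro g hg
        obtain ⟨h, hh, rfl⟩ := (hJ' g).1 hg
        refine (hJ' _).2 ⟨σ h, hσS h hh, ?_⟩
        ext w
        obtain ⟨v, rfl⟩ := hsurj w
        rw [hσ, Finsupp.filter_apply, Finsupp.filter_apply, hσ]
        by_cases hv : h v = 0
        · simp [hv]
        · rw [hTB v (hsupp h ((hJ₁ h).1 hh).1 v hv)]
          split_ifs <;> simp
      · refine ⟨Finsupp.filter (fun v => T v = 0) f, (hJ' _).2 ⟨f, ?_, rfl⟩, ?_⟩
        · rw [hJ₁]
          exact ⟨hfJ, (hcos f S).1 (le_refl _)⟩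
        · intro hcon
          have := DFunLike.congr_fun hcon 0
          rw [Finsupp.filter_apply_pos _ _ (by simp)] at this
          exact hf00 this
    obtain ⟨h, hh, hh1⟩ := (hJ' _).1 h1
    have hhz : ∀ v, T v = 0 → h v = Finsupp.single (0 : M) (1 : ℂ) v := by
      intro v hv
      rw [← hh1, Finsupp.filter_apply, if_pos hv]
    have hhJ := ((hJ₁ h).1 hh).1
    -- `σ h - h` has fewer cosets, so it vanishes
    have hinv0 : σ h - h = 0 := by
      by_contra hcon
      have hmemd : σ h - h ∈ J₁ := J₁.sub_mem (hσS h hh) hh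
      have hlow := hmin _ ((hJ₁ _).1 hmemd).1 hcon
      have hsub : cos (σ h - h) ⊆ S.erase 0 := by
        rw [hcos]
        intro w hw
        refine Finset.mem_erase.2 ⟨fun hTw => hw ?_, ((hJ₁ _).1 hmemd).2 w hw⟩
        rw [Finsupp.sub_apply, hhz w hTw]
        obtain ⟨v, rfl⟩ := hsurj w
        rw [hσ]
        by_cases hv : h v = 0
        · have hv0 : v + P v ≠ 0 := by
            intro h0
            have : v = 0 := by
              apply ((Module.End.isUnit_iff _).1 hU).1
              simpa using h0
            rw [this, hhz 0 (by simp)] at hv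
            simp at hv
          rw [hv, Finsupp.single_eq_of_ne hv0]; simp
        · have hTv : T v = 0 := by rw [← hTB v (hsupp h hhJ v hv)]; exact hTw
          have hvv : v = 0 := by
            by_contra hne0
            rw [hhz v hTv, Finsupp.single_eq_of_ne hne0] at hv
            exact hv rfl
          subst hvv
          rw [hhz 0 hTv]
          simp [hγ1]
      have := Finset.card_le_card hsub
      rw [Finset.card_erase_of_mem h0S] at this
      have hpos : 0 < S.card := Finset.card_pos.2 ⟨0, h0S⟩
      omega
    have hinv : ∀ v, h (v + P v) = γ v * h v := by
      intro v
      rw [← hσ h v, sub_eq_zero.1 hinv0]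
    have hone : h = Finsupp.single 0 1 := by
      ext v
      by_cases hv : v = 0
      · rw [hv, hhz 0 (by simp)]
      · rw [Finsupp.single_eq_of_ne hv]
        by_contra hcon
        exact hv (aux_invariant htf P m hP γ hγ0 hγ h hinv v hcon)
    rw [← hone]
    exact hhJ

end Aux

/-- The character of the torus attached to an integer vector. -/
def torusChar {N : ℕ} (v : Fin N → ℤ) (y : Fin N → ℂˣ) : ℂˣ := ∏ i, y i ^ v i

theorem torusChar_add {N : ℕ} (u v : Fin N → ℤ) (y : Fin N → ℂˣ) :
    torusChar (u + v) y = torusChar u y * torusChar v y := by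
  simp [torusChar, zpow_add, Finset.prod_mul_distrib]

theorem torusChar_zero {N : ℕ} (y : Fin N → ℂˣ) : torusChar 0 y = 1 := by
  simp [torusChar]

/-- A unipotent monomial map composed with a translation on the torus `(ℂˣ)^N`,
whose translation part pairs with every fixed integer covector to a non-root of
unity, is wild: every forward orbit is Zariski dense. -/
theorem stmt_8 (N : ℕ) (hN : 0 < N) (A : Matrix (Fin N) (Fin N) ℤ)
    (m : ℕ) (hm : 0 < m) (hA : (A - 1) ^ m = 0)
    (c : Fin N → ℂˣ)
    (φ : (Fin N → ℂˣ) → (Fin N → ℂˣ))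
    (hφ : ∀ (x : Fin N → ℂˣ) (i : Fin N), φ x i = c i * ∏ j, x j ^ A i j)
    (hc : ∀ v : Fin N → ℤ, v ≠ 0 → A.transpose.mulVec v = v →
      ¬∃ k : ℕ, 0 < k ∧ (∏ i, c i ^ v i) ^ k = 1)
    (x : Fin N → ℂˣ) (f : MvPolynomial (Fin N) ℂ)
    (hf : ∀ k : ℕ, MvPolynomial.eval (fun i => ((φ^[k] x) i : ℂ)) f = 0) :
    f = 0 := by
  classical
  by_contra hf0
  let P : Module.End ℤ (Fin N → ℤ) := Matrix.toLinAlgEquiv' (A.transpose - 1)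
  have hPv : ∀ v, v + P v = A.transpose.mulVec v := by
    intro v
    simp [P]
  have hP : P ^ m = 0 := by
    have : (A.transpose - 1) ^ m = 0 := by
      rw [← Matrix.transpose_one, ← Matrix.transpose_sub, ← Matrix.transpose_pow, hA,
        Matrix.transpose_zero]
    rw [← map_pow, this, map_zero]
  have hchar : ∀ v y, torusChar v (φ y) = torusChar v c * torusChar (v + P v) y := by
    intro v y
    rw [hPv]
    simp only [torusChar, hφ, mul_zpow, Finset.prod_mul_distrib]
    congr 1
    simp only [Matrix.mulVec, dotProduct, Matrix.transpose_apply, ← Finset.prod_zpow, ← zpow_mul]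
    rw [Finset.prod_comm]
    refine Finset.prod_congr rfl fun j _ => ?_
    induction (Finset.univ : Finset (Fin N)) using Finset.induction_on with
    | empty => simp
    | insert a s ha ih => rw [Finset.prod_insert ha, Finset.sum_insert ha, zpow_add, ih]
  let γ : (Fin N → ℤ) → ℂ := fun v => (torusChar v c : ℂ)
  let ev : ℕ → ((Fin N → ℤ) →₀ ℂ) →ₗ[ℂ] ℂ := fun k =>
    Finsupp.linearCombination ℂ (fun v => (torusChar v (φ^[k] x) : ℂ))
  let σ : ((Fin N → ℤ) →₀ ℂ) →ₗ[ℂ] ((Fin N → ℤ) →₀ ℂ) :=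
    Finsupp.linearCombination ℂ (fun v => Finsupp.single (v + P v) (γ v))
  have hU : IsUnit (1 + P) := IsNilpotent.isUnit_one_add ⟨m, hP⟩
  have hinj : Function.Injective (fun v => v + P v) := by
    intro u v huv
    apply ((Module.End.isUnit_iff _).1 hU).1
    simpa using huv
  have hσ : ∀ h v, σ h (v + P v) = γ v * h v := by
    intro h v
    induction h using Finsupp.induction_linear with
    | zero => simp
    | add f g hf hg => rw [map_add σ, Finsupp.add_apply, hf, hg, Finsupp.add_apply, mul_add]
    | single a b =>
      simp only [σ, Finsupp.linearCombination_single, Finsupp.smul_single, smul_eq_mul]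
      by_cases hav : v = a
      · subst hav; simp [mul_comm]
      · rw [Finsupp.single_eq_of_ne hav, Finsupp.single_eq_of_ne (fun h => hav (hinj h))]
        simp
  have hevσ : ∀ k h, ev k (σ h) = ev (k + 1) h := by
    intro k h
    induction h using Finsupp.induction_linear with
    | zero => simp
    | add f g hf hg => rw [map_add, map_add, map_add, hf, hg]
    | single a b =>
      simp only [σ, ev, Finsupp.linearCombination_single, Finsupp.smul_single, smul_eq_mul,
        Function.iterate_succ_apply', hchar, γ, Units.val_mul]
      ring
  have hevmul : ∀ k h u, ev k (Finsupp.equivMapDomain (Equiv.addLeft u) h)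
      = torusChar u (φ^[k] x) * ev k h := by
    intro k h u
    rw [Finsupp.equivMapDomain_eq_mapDomain]
    simp only [ev]
    rw [Finsupp.linearCombination_mapDomain]
    simp only [Finsupp.linearCombination_apply, Finsupp.sum, Finset.mul_sum]
    refine Finset.sum_congr rfl fun v _ => ?_
    simp [torusChar_add]
    ring
  let J : Submodule ℂ ((Fin N → ℤ) →₀ ℂ) := ⨅ k, LinearMap.ker (ev k)
  have hJ : ∀ g, g ∈ J ↔ ∀ k, ev k g = 0 := by
    intro g; simp [J]
  let ι : (Fin N →₀ ℕ) → (Fin N → ℤ) := fun e i => (e i : ℤ)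
  have hι : Function.Injective ι := by
    intro e e' h
    ext i
    have := congrFun h i
    simpa [ι] using this
  let F : (Fin N →₀ ℕ) →₀ ℂ := Finsupp.onFinset f.support (fun e => f.coeff e) (by
    intro e he; simpa using he)
  have hFs : F.support = f.support := by
    ext e; simp [F]
  have h1 : Finsupp.single 0 1 ∈ J := by
    refine aux_main ?_ P m hP γ ?_ ?_ ?_ σ hσ m J ?_ ?_ ?_ ?_
    · intro k u hk hu
      ext i
      have := congrFun hu i
      simp at this
      rcases this with h | h
      · omega
      · simpa using h
    · simp [γ, torusChar_zero]
    · intro v; simp [γ]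
    · intro v hv hγv
      by_contra hne
      refine hc v hne (by rw [← hPv, hv, add_zero]) ⟨1, one_pos, ?_⟩
      rw [pow_one]
      exact Units.ext hγv
    · intro f _ v _; simp [hP]
    · intro f hf u _
      rw [hJ] at hf ⊢
      intro k
      rw [hevmul, hf k, mul_zero]
    · intro f hf
      rw [hJ] at hf ⊢
      intro k
      rw [hevσ, hf]
    · refine ⟨Finsupp.mapDomain ι F, ?_, ?_⟩
      · rw [hJ]
        intro k
        rw [← hf k, MvPolynomial.eval_eq']
        simp only [ev]
        rw [Finsupp.linearCombination_mapDomain, Finsupp.linearCombination_apply, Finsupp.sum, hFs]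
        refine Finset.sum_congr rfl fun e _ => ?_
        simp [F, ι, torusChar]
      · intro hcon
        have hF0 : F = 0 := by
          apply Finsupp.mapDomain_injective hι
          rw [hcon, Finsupp.mapDomain_zero]
        apply hf0
        rw [← MvPolynomial.support_eq_empty, ← hFs, hF0, Finsupp.support_zero]
  have := (hJ _).1 h1 0
  simp [ev, torusChar_zero] at this
end

section
/- Let N be a positive integer, let A be an N×N integer matrix with (A − I)^m = 0 for some positive integer m, let c ∈ (ℂˣ)^N, and define φ : (ℂˣ)^N → (ℂˣ)^N by letting the i-th coordinate of φ(x) be c_i · ∏_j x_j^{A_{ij}} (integer exponents). Assume that for every nonzero vector v ∈ ℤ^N with Aᵀv = v, the number ∏_i c_i^{v_i} is not a root of unity. If Z ⊆ (ℂˣ)^N is nonempty, is the set of common zeros in (ℂˣ)^N of some set of polynomials in N variables over ℂ, and satisfies φ(Z) = Z, then Z = (ℂˣ)^N. -/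
namespace TorusAux

open Finsupp

variable {G : Type*} [AddCommGroup G]

/-- The twisted pushforward `x^v ↦ χ(v) x^{Bv}`. -/
noncomputable def sig (B : AddMonoid.End G) (χ : G → ℂ) : (G →₀ ℂ) →ₗ[ℂ] (G →₀ ℂ) :=
  Finsupp.linearCombination ℂ (fun v => Finsupp.single (B v) (χ v))

/-- Multiplication by the monomial `x^w`. -/
noncomputable def tr (w : G) : (G →₀ ℂ) →ₗ[ℂ] (G →₀ ℂ) :=
  Finsupp.linearCombination ℂ (fun v => Finsupp.single (v + w) (1 : ℂ))

lemma sig_single (B : AddMonoid.End G) (χ : G → ℂ) (v : G) (a : ℂ) :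
    sig B χ (single v a) = single (B v) (a * χ v) := by
  simp [sig]

lemma tr_single (w v : G) (a : ℂ) : tr w (single v a) = single (v + w) a := by
  simp [tr]

lemma sig_apply (B : AddMonoid.End G) (hB : Function.Injective B) (χ : G → ℂ)
    (f : G →₀ ℂ) (v : G) : sig B χ f (B v) = f v * χ v := by
  induction f using Finsupp.induction_linear with
  | zero => simp
  | add f g hf hg => simp [hf, hg, add_mul]
  | single w a =>
    rw [sig_single]
    by_cases h : w = v
    · subst h; simp
    · have : B w ≠ B v := fun h' => h (hB h')
      simp [Finsupp.single_apply, h, this]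

lemma tr_apply (w : G) (f : G →₀ ℂ) (v : G) : tr w f v = f (v - w) := by
  induction f using Finsupp.induction_linear with
  | zero => simp
  | add f g hf hg => simp [hf, hg]
  | single u a =>
    rw [tr_single]
    classical
    by_cases h : u + w = v
    · have h' : u = v - w := eq_sub_of_add_eq h
      rw [Finsupp.single_apply, Finsupp.single_apply, if_pos h, if_pos h']
    · have h' : ¬ u = v - w := fun h' => h (by rw [h']; abel)
      rw [Finsupp.single_apply, Finsupp.single_apply, if_neg h, if_neg h']

lemma sig_supported (B : AddMonoid.End G) (χ : G → ℂ) (f : G →₀ ℂ) (T : Set G)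
    (hT : ∀ v ∈ T, B v ∈ T) (hf : f ∈ supported ℂ ℂ T) : sig B χ f ∈ supported ℂ ℂ T := by
  have h : sig B χ f = f.sum (fun v a => single (B v) (a * χ v)) := by
    rw [sig, linearCombination_apply]
    simp
  rw [h]
  refine Submodule.sum_mem _ fun v hv => ?_
  exact single_mem_supported ℂ _ (hT v (hf hv))

lemma tr_supported (w : G) (f : G →₀ ℂ) (T U : Set G)
    (hT : ∀ v ∈ T, v + w ∈ U) (hf : f ∈ supported ℂ ℂ T) : tr w f ∈ supported ℂ ℂ U := by
  have h : tr w f = f.sum (fun v a => single (v + w) a) := by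
    rw [tr, linearCombination_apply]
    simp
  rw [h]
  refine Submodule.sum_mem _ fun v hv => ?_
  exact single_mem_supported ℂ _ (hT v (hf hv))

lemma fixed_of_finite [IsAddTorsionFree G] (D : AddMonoid.End G) (S : Set G) (hS : S.Finite)
    (hst : ∀ v ∈ S, (1 + D) v ∈ S) (v : G) (hv : v ∈ S) :
    ∀ j : ℕ, (D ^ j) v = 0 → D v = 0 := by
  have hn : ∀ n : ℕ, ((1 + D) ^ n) v ∈ S := by
    intro n
    induction n with
    | zero => simpa using hv
    | succ n ih => rw [pow_succ']; exact hst _ ih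
  intro j
  induction j with
  | zero =>
    intro h
    have : v = 0 := by simpa using h
    simp [this]
  | succ j ih =>
    intro h
    cases j with
    | zero => simpa using h
    | succ j =>
      apply ih
      by_contra hz
      set z := (D ^ (j + 1)) v with hzdef
      set w := (D ^ j) v with hw
      have hDw : D w = z := by rw [hzdef, pow_succ']; rfl
      have hDz : D z = 0 := by rw [← h, pow_succ' D (j + 1)]; rfl
      have hform : ∀ n : ℕ, ((1 + D) ^ n) w = w + n • z := by
        intro n
        induction n with
        | zero => simp
        | succ n ih =>
          rw [pow_succ']
          change (1 + D) (((1 + D) ^ n) w) = _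
          rw [ih]
          change (w + n • z) + D (w + n • z) = _
          rw [map_add, map_nsmul, hDw, hDz, succ_nsmul]
          simp [add_assoc]
      have hmem : ∀ n : ℕ, w + n • z ∈ (D ^ j) '' S := by
        intro n
        refine ⟨((1 + D) ^ n) v, hn n, ?_⟩
        rw [← hform n]
        have hc : D ^ j * (1 + D) ^ n = (1 + D) ^ n * D ^ j :=
          (((Commute.one_right D).add_right (Commute.refl D)).pow_pow j n).eq
        exact congrArg (fun E : AddMonoid.End G => E v) hc
      have hinj : Function.Injective (fun n : ℕ => w + n • z) := by
        intro a b hab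
        have : a • z = b • z := add_left_cancel hab
        have h3 : ((a : ℤ) - b) • z = 0 := by
          rw [sub_smul, natCast_zsmul, natCast_zsmul, this, sub_self]
        rcases smul_eq_zero.1 h3 with h4 | h4
        · lia
        · exact absurd h4 hz
      exact Set.infinite_of_injective_forall_mem hinj hmem (hS.image _)

lemma sig_fixed [IsAddTorsionFree G] (D : AddMonoid.End G) (m : ℕ) (hD : D ^ m = 0)
    (hB : Function.Injective (1 + D : AddMonoid.End G))
    (χ : G → ℂ) (hχ : ∀ v, v ≠ 0 → D v = 0 → χ v ≠ 1)
    (hχ0 : ∀ v, χ v ≠ 0)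
    (g : G →₀ ℂ) (hg : sig (1 + D) χ g = g) (v : G) (hv : g v ≠ 0) : v = 0 := by
  by_contra hne
  have hDv : D v = 0 := by
    refine fixed_of_finite D (g.support : Set G) g.support.finite_toSet ?_ v (by simpa using hv) m
      (by rw [hD]; rfl)
    intro u hu
    have h := sig_apply (1 + D) hB χ g u
    rw [hg] at h
    simp only [Finset.mem_coe, Finsupp.mem_support_iff] at hu ⊢
    rw [h]
    exact mul_ne_zero hu (hχ0 u)
  have h := sig_apply (1 + D) hB χ g v
  have h1 : (1 + D) v = v := by
    change v + D v = v
    rw [hDv, add_zero]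
  rw [hg, h1] at h
  exact hχ v hne hDv (mul_left_cancel₀ hv (by rw [← h, mul_one]))

/-- The filtration by kernels of powers of `D`. -/
def LL (D : AddMonoid.End G) (d : ℕ) : AddSubgroup G := AddMonoidHom.ker (D ^ d : AddMonoid.End G)

lemma mem_LL (D : AddMonoid.End G) (d : ℕ) (v : G) : v ∈ LL D d ↔ (D ^ d) v = 0 := Iff.rfl

lemma D_mem_LL (D : AddMonoid.End G) (d : ℕ) (v : G) (hv : v ∈ LL D (d + 1)) : D v ∈ LL D d := by
  rw [mem_LL] at hv ⊢
  rw [← hv, pow_succ]; rfl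

lemma LL_le (D : AddMonoid.End G) (d : ℕ) (v : G) (hv : v ∈ LL D d) : v ∈ LL D (d + 1) := by
  rw [mem_LL] at hv ⊢
  rw [pow_succ']
  change D ((D ^ d) v) = 0
  rw [hv, map_zero]

theorem key [IsAddTorsionFree G] (D : AddMonoid.End G) (m : ℕ) (hD : D ^ m = 0)
    (hB : Function.Injective (1 + D : AddMonoid.End G))
    (χ : G → ℂ) (hχ : ∀ v, v ≠ 0 → D v = 0 → χ v ≠ 1)
    (hχ0 : ∀ v, χ v ≠ 0) (hχ1 : χ 0 = 1) (d : ℕ) :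
    ∀ (I : Submodule ℂ (G →₀ ℂ)) (_ : ∀ w ∈ LL D d, ∀ f ∈ I, tr w f ∈ I)
      (_ : ∀ f ∈ I, sig (1 + D) χ f ∈ I) (f : G →₀ ℂ) (_ : f ∈ I)
      (_ : f ∈ supported ℂ ℂ (LL D d : Set G)) (_ : f ≠ 0), single (0 : G) (1 : ℂ) ∈ I := by
  classical
  induction d with
  | zero =>
    intro I _ _ f hfI hfs hf0
    have hf : f = single 0 (f 0) := by
      ext v
      by_cases hv : v = 0
      · simp [hv]
      · have : f v = 0 := by
          by_contra h
          have := hfs (Finsupp.mem_support_iff.2 h)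
          have h2 : (D ^ 0) v = 0 := this
          exact hv (by simpa using h2)
        simp [this, Finsupp.single_apply, Ne.symm hv]
    have h0 : f 0 ≠ 0 := by
      intro h
      rw [h] at hf
      exact hf0 (by simpa using hf)
    have := I.smul_mem (f 0)⁻¹ hfI
    rw [hf] at this
    simpa [h0] using this
  | succ d ih =>
    intro I htr hsig f₀ hf₀I hf₀s hf₀0
    let q : G → G ⧸ LL D d := QuotientAddGroup.mk
    let P : ℕ → Prop := fun k => ∃ f ∈ I, f ∈ supported ℂ ℂ (LL D (d + 1) : Set G) ∧ f ≠ 0 ∧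
      (f.support.image q).card = k
    have hP : ∃ k, P k := ⟨_, f₀, hf₀I, hf₀s, hf₀0, rfl⟩
    obtain ⟨f₁, hf₁I, hf₁s, hf₁0, hf₁c⟩ := Nat.find_spec hP
    have hmin : ∀ h ∈ I, h ∈ supported ℂ ℂ (LL D (d + 1) : Set G) →
        (h.support.image q).card < Nat.find hP → h = 0 := by
      intro h hI hs hc
      by_contra hne
      exact Nat.find_min hP hc ⟨h, hI, hs, hne, rfl⟩
    obtain ⟨v₁, hv₁⟩ := Finsupp.support_nonempty_iff.2 hf₁0
    have hv₁L : v₁ ∈ LL D (d + 1) := hf₁s hv₁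
    set f := tr (-v₁) f₁ with hf
    have hfI : f ∈ I := htr _ (neg_mem hv₁L) _ hf₁I
    have hfs : f ∈ supported ℂ ℂ (LL D (d + 1) : Set G) :=
      tr_supported _ _ _ _ (fun v hv => add_mem hv (neg_mem hv₁L)) hf₁s
    have hf0 : f 0 ≠ 0 := by
      rw [hf, tr_apply]
      simpa using hv₁
    have hfc : (f.support.image q).card ≤ Nat.find hP := by
      rw [← hf₁c]
      have : f.support.image q ⊆ (f₁.support.image q).image (fun t => t - q v₁) := by
        intro t ht
        obtain ⟨v, hv, rfl⟩ := Finset.mem_image.1 ht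
        refine Finset.mem_image.2 ⟨q (v + v₁), Finset.mem_image.2 ⟨v + v₁, ?_, rfl⟩, ?_⟩
        · rw [Finsupp.mem_support_iff, hf, tr_apply] at hv
          simpa using hv
        · change q (v + v₁) - q v₁ = q v
          change ((v + v₁ : G) : G ⧸ LL D d) - (v₁ : G ⧸ LL D d) = (v : G ⧸ LL D d)
          rw [QuotientAddGroup.mk_add, add_sub_cancel_right]
      exact (Finset.card_le_card this).trans Finset.card_image_le
    let T : Set G := {v | v ∈ LL D (d + 1) ∧ q v ∈ f.support.image q ∧ v ∉ LL D d}
    have hTmin : ∀ h ∈ I, h ∈ supported ℂ ℂ T → h = 0 := by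
      intro h hI hs
      refine hmin h hI (fun v hv => (hs hv).1) (lt_of_lt_of_le ?_ hfc)
      apply Finset.card_lt_card
      rw [Finset.ssubset_iff_of_subset]
      · refine ⟨q 0, Finset.mem_image.2 ⟨0, by simpa using hf0, rfl⟩, ?_⟩
        intro hm
        obtain ⟨v, hv, hq⟩ := Finset.mem_image.1 hm
        exact (hs hv).2.2 ((QuotientAddGroup.eq_zero_iff v).1 hq)
      · intro t ht
        obtain ⟨v, hv, rfl⟩ := Finset.mem_image.1 ht
        exact (hs hv).2.1
    have hTtr : ∀ w ∈ LL D d, ∀ v ∈ T, v + w ∈ T := by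
      intro w hw v hv
      refine ⟨add_mem hv.1 (LL_le D d w hw), ?_, ?_⟩
      · have : q (v + w) = q v := by
          change ((v + w : G) : G ⧸ LL D d) = (v : G ⧸ LL D d)
          rw [QuotientAddGroup.mk_add, (QuotientAddGroup.eq_zero_iff w).2 hw, add_zero]
        rw [this]; exact hv.2.1
      · intro h
        exact hv.2.2 (by simpa using sub_mem h hw)
    have hTsig : ∀ v ∈ T, (1 + D) v ∈ T := fun v hv => hTtr (D v) (D_mem_LL D d v hv.1) v hv
    have hLsig : ∀ v ∈ LL D d, (1 + D) v ∈ LL D d := fun v hv =>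
      add_mem hv (D_mem_LL D d v (LL_le D d v hv))
    let J : Submodule ℂ (G →₀ ℂ) :=
      supported ℂ ℂ (LL D d : Set G) ⊓ (I ⊔ supported ℂ ℂ T)
    have h1 : single (0 : G) (1 : ℂ) ∈ J := by
      refine ih J ?_ ?_ (f.filter (· ∈ LL D d)) ?_ ?_ ?_
      · rintro w hw a ⟨ha, haI⟩
        refine ⟨tr_supported _ _ _ _ (fun v hv => add_mem hv hw) ha, ?_⟩
        obtain ⟨i, hi, g, hg, rfl⟩ := Submodule.mem_sup.1 haI
        rw [map_add]
        exact Submodule.add_mem_sup (htr w (LL_le D d w hw) i hi)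
          (tr_supported _ _ _ _ (hTtr w hw) hg)
      · rintro a ⟨ha, haI⟩
        refine ⟨sig_supported _ _ _ _ hLsig ha, ?_⟩
        obtain ⟨i, hi, g, hg, rfl⟩ := Submodule.mem_sup.1 haI
        rw [map_add]
        exact Submodule.add_mem_sup (hsig i hi) (sig_supported _ _ _ _ hTsig hg)
      · refine ⟨?_, ?_⟩
        · intro v hv
          have hv' : v ∈ (f.filter (· ∈ LL D d)).support := hv
          rw [Finsupp.support_filter, Finset.mem_filter] at hv'
          exact hv'.2
        · have hsum := Finsupp.filter_pos_add_filter_neg f (· ∈ LL D d)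
          rw [← eq_sub_iff_add_eq] at hsum
          rw [hsum, sub_eq_add_neg]
          refine Submodule.add_mem_sup hfI (neg_mem ?_)
          intro v hv
          have hv' : v ∈ (f.filter (fun a => ¬ a ∈ LL D d)).support := hv
          rw [Finsupp.support_filter, Finset.mem_filter] at hv'
          exact ⟨hfs hv'.1, Finset.mem_image_of_mem _ hv'.1, hv'.2⟩
      · intro v hv
        have hv' : v ∈ (f.filter (· ∈ LL D d)).support := hv
        rw [Finsupp.support_filter, Finset.mem_filter] at hv'
        exact hv'.2
      · intro h
        have := DFunLike.congr_fun h 0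
        rw [Finsupp.filter_apply_pos _ _ (zero_mem _)] at this
        exact hf0 (by simpa using this)
    obtain ⟨i, hi, g, hg, hig⟩ := Submodule.mem_sup.1 h1.2
    have hs1 : sig (1 + D) χ (single (0 : G) (1 : ℂ)) = single 0 1 := by
      rw [sig_single, map_zero, hχ1, mul_one]
    have hfix : sig (1 + D) χ g - g = 0 := by
      apply hTmin
      · have : sig (1 + D) χ g - g = i - sig (1 + D) χ i := by
          have h2 : g = single 0 1 - i := by rw [← hig]; abel
          rw [h2, map_sub, hs1]; abel
        rw [this]
        exact sub_mem hi (hsig i hi)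
      · exact sub_mem (sig_supported _ _ _ _ hTsig hg) hg
    have hg0 : g = 0 := by
      ext v
      by_contra hv
      have hv' : g v ≠ 0 := hv
      have := sig_fixed D m hD hB χ hχ hχ0 g (sub_eq_zero.1 hfix) v hv'
      have hvT : v ∈ T := hg (Finsupp.mem_support_iff.2 hv')
      rw [this] at hvT
      exact hvT.2.2 (zero_mem _)
    rw [← hig, hg0, add_zero]
    exact hi

/-- Character `x ↦ x^v`. -/
def mon {N : ℕ} (x : Fin N → ℂˣ) (v : Fin N → ℤ) : ℂˣ := ∏ j, x j ^ v j

lemma mon_add {N : ℕ} (x : Fin N → ℂˣ) (v w : Fin N → ℤ) :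
    mon x (v + w) = mon x v * mon x w := by
  simp [mon, zpow_add, Finset.prod_mul_distrib]

/-- Evaluation of a Laurent polynomial. -/
noncomputable def ev {N : ℕ} (x : Fin N → ℂˣ) : ((Fin N → ℤ) →₀ ℂ) →ₗ[ℂ] ℂ :=
  Finsupp.linearCombination ℂ (fun v => (mon x v : ℂ))

lemma ev_single {N : ℕ} (x : Fin N → ℂˣ) (v : Fin N → ℤ) (a : ℂ) :
    ev x (single v a) = a * mon x v := by
  simp [ev]

lemma ev_tr {N : ℕ} (x : Fin N → ℂˣ) (w : Fin N → ℤ) (f : (Fin N → ℤ) →₀ ℂ) :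
    ev x (tr w f) = ev x f * mon x w := by
  induction f using Finsupp.induction_linear with
  | zero => simp
  | add f g hf hg => simp [hf, hg, add_mul]
  | single v a => rw [tr_single, ev_single, ev_single, mon_add]; push_cast; ring

lemma zpow_fsum {N : ℕ} (x : ℂˣ) (s : Finset (Fin N)) (e : Fin N → ℤ) :
    x ^ (∑ i ∈ s, e i) = ∏ i ∈ s, x ^ e i := by
  classical
  induction s using Finset.induction_on with
  | empty => simp
  | insert a s ha ih => rw [Finset.sum_insert ha, Finset.prod_insert ha, zpow_add, ih]

lemma mon_phi {N : ℕ} (A : Matrix (Fin N) (Fin N) ℤ) (c x y : Fin N → ℂˣ)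
    (hy : ∀ i, y i = c i * ∏ j, x j ^ A i j) (v : Fin N → ℤ) :
    mon y v = mon c v * mon x (A.transpose.mulVec v) := by
  simp only [mon, hy, mul_zpow, Finset.prod_mul_distrib]
  congr 1
  simp only [← Finset.prod_zpow]
  rw [Finset.prod_comm]
  refine Finset.prod_congr rfl fun j _ => ?_
  simp only [Matrix.mulVec, dotProduct, Matrix.transpose_apply]
  rw [zpow_fsum]
  refine Finset.prod_congr rfl fun i _ => ?_
  rw [zpow_mul]

/-- Polynomial as Laurent polynomial. -/
noncomputable def toL {N : ℕ} (p : MvPolynomial (Fin N) ℂ) : (Fin N → ℤ) →₀ ℂ :=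
  ∑ n ∈ p.support, single (fun i => (n i : ℤ)) (p.coeff n)

lemma ev_toL {N : ℕ} (x : Fin N → ℂˣ) (p : MvPolynomial (Fin N) ℂ) :
    ev x (toL p) = MvPolynomial.eval (fun i => (x i : ℂ)) p := by
  rw [toL, map_sum, MvPolynomial.eval_eq']
  refine Finset.sum_congr rfl fun n _ => ?_
  rw [ev_single]
  simp [mon]

lemma toL_eq_zero {N : ℕ} (p : MvPolynomial (Fin N) ℂ) (h : toL p = 0) : p = 0 := by
  classical
  ext n
  by_contra hn
  have hn' : p.coeff n ≠ 0 := by simpa using hn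
  have h2 := DFunLike.congr_fun h (fun i => (n i : ℤ))
  rw [toL, Finsupp.finset_sum_apply, Finset.sum_eq_single n] at h2
  · simp at h2
    exact hn' h2
  · intro k _ hk
    rw [Finsupp.single_apply, if_neg]
    intro he
    apply hk
    ext i
    have := congrFun he i
    exact_mod_cast this
  · intro hns
    exact absurd (MvPolynomial.mem_support_iff.2 hn') hns

end TorusAux

/-- A unipotent monomial map composed with a translation on the torus `(ℂˣ)^N`,
whose translation part pairs with every fixed integer covector to a non-root of
unity, has no nonempty proper invariant Zariski closed subset. -/
theorem stmt_9 (N : ℕ) (hN : 0 < N) (A : Matrix (Fin N) (Fin N) ℤ)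
    (m : ℕ) (hm : 0 < m) (hA : (A - 1) ^ m = 0)
    (c : Fin N → ℂˣ)
    (φ : (Fin N → ℂˣ) → (Fin N → ℂˣ))
    (hφ : ∀ (x : Fin N → ℂˣ) (i : Fin N), φ x i = c i * ∏ j, x j ^ A i j)
    (hc : ∀ v : Fin N → ℤ, v ≠ 0 → A.transpose.mulVec v = v →
      ¬∃ k : ℕ, 0 < k ∧ (∏ i, c i ^ v i) ^ k = 1)
    (Z : Set (Fin N → ℂˣ)) (hZne : Z.Nonempty)
    (hZcl : ∃ S : Set (MvPolynomial (Fin N) ℂ),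
      Z = {x : Fin N → ℂˣ | ∀ f ∈ S, MvPolynomial.eval (fun i => (x i : ℂ)) f = 0})
    (hZinv : φ '' Z = Z) :
    Z = Set.univ := by
  obtain ⟨S, hS⟩ := hZcl
  let D : AddMonoid.End (Fin N → ℤ) := ((A - 1).transpose.mulVecLin).toAddMonoidHom
  have hDa : ∀ v, D v = (A - 1).transpose.mulVec v := fun v => rfl
  have hDp : ∀ (k : ℕ) v, (D ^ k) v = ((A - 1) ^ k).transpose.mulVec v := by
    intro k
    induction k with
    | zero => intro v; simp
    | succ k ih =>
      intro v
      rw [pow_succ]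
      change (D ^ k) (D v) = _
      rw [ih, hDa, Matrix.mulVec_mulVec, ← Matrix.transpose_mul, ← pow_succ']
  have hD : D ^ m = 0 := by
    ext1 v
    rw [hDp, hA]
    simp
  have hBa : ∀ v, (1 + D) v = A.transpose.mulVec v := by
    intro v
    change v + D v = _
    rw [hDa, Matrix.transpose_sub, Matrix.sub_mulVec]
    simp
  have hB : Function.Injective (1 + D : AddMonoid.End (Fin N → ℤ)) := by
    have hu : IsUnit (1 + D) := IsNilpotent.isUnit_one_add ⟨m, hD⟩
    obtain ⟨u, hu⟩ := hu
    intro a b hab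
    rw [← hu] at hab
    have h := congrArg (fun t => (u⁻¹).val t) hab
    have h2 : ∀ t, (u⁻¹).val (u.val t) = t := fun t =>
      congrArg (fun E : AddMonoid.End (Fin N → ℤ) => E t) u.inv_mul
    simpa only [h2] using h
  let χ : (Fin N → ℤ) → ℂ := fun v => (TorusAux.mon c v : ℂ)
  have hχ : ∀ v, v ≠ 0 → D v = 0 → χ v ≠ 1 := by
    intro v hv hDv h
    refine hc v hv ?_ ⟨1, one_pos, ?_⟩
    · rw [← hBa]
      change v + D v = v
      rw [hDv, add_zero]
    · rw [pow_one]
      exact Units.ext h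
  let I : Submodule ℂ ((Fin N → ℤ) →₀ ℂ) := ⨅ x ∈ Z, LinearMap.ker (TorusAux.ev x)
  have hI : ∀ f, f ∈ I ↔ ∀ x ∈ Z, TorusAux.ev x f = 0 := by
    intro f
    simp [I, Submodule.mem_iInf]
  have hev : ∀ x f, TorusAux.ev x (TorusAux.sig (1 + D) χ f) = TorusAux.ev (φ x) f := by
    intro x f
    induction f using Finsupp.induction_linear with
    | zero => simp
    | add f g hf hg => simp [hf, hg]
    | single v a =>
      rw [TorusAux.sig_single, TorusAux.ev_single, TorusAux.ev_single,
        TorusAux.mon_phi A c x (φ x) (hφ x), hBa]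
      push_cast
      ring
  have hzero : ∀ f ∈ S, f = 0 := by
    intro p hp
    by_contra hne
    have h1 := TorusAux.key D m hD hB χ hχ (fun v => Units.ne_zero _) (by simp [χ, TorusAux.mon])
      m I ?_ ?_ (TorusAux.toL p) ?_ ?_ (fun h => hne (TorusAux.toL_eq_zero p h))
    · obtain ⟨x, hx⟩ := hZne
      have := (hI _).1 h1 x hx
      rw [TorusAux.ev_single] at this
      simp at this
    · intro w _ f hf
      rw [hI] at hf ⊢
      intro x hx
      rw [TorusAux.ev_tr, hf x hx, zero_mul]
    · intro f hf
      rw [hI] at hf ⊢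
      intro x hx
      rw [hev]
      exact hf _ (hZinv ▸ Set.mem_image_of_mem φ hx)
    · rw [hI]
      intro x hx
      rw [TorusAux.ev_toL]
      rw [hS] at hx
      exact hx p hp
    · intro v _
      change (D ^ m) v = 0
      rw [hD]; rfl
  rw [hS]
  ext x
  simp only [Set.mem_setOf_eq, Set.mem_univ, iff_true]
  intro f hf
  rw [hzero f hf, map_zero]
end
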